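/- arXiv:2203.05030 — 2 statements merged into one kernel-verified Lean document; each statement's English description precedes it below -/
import Mathlib

section
/- Fix an integer k ≥ 2. The function h_k is rigid in H¹ in the following sense: if G ∈ L¹(𝕋, m) has vanishing negative Fourier coefficients (i.e., Ĝ(n) = ∫_𝕋 G(ω) ω^{−n} dm(ω) = 0 for all n < 0) and there exists a measurable function ρ : 𝕋 → [0, ∞) with G(ω) = ρ(ω)·h_k(ω) for m-almost every ω (i.e., G has the same argument as h_k a.e.), then G = λ·h_k m-almost everywhere for some constant λ ≥ 0. -/
open MeasureTheory Complex

noncomputable section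

/-- Normalized Lebesgue (arc-length) measure on the unit circle, as a measure on `ℂ`. -/
def mCirc : Measure ℂ :=
  (ENNReal.ofReal (2 * Real.pi))⁻¹ •
    Measure.map (fun θ : ℝ => Complex.exp (θ * Complex.I))
      (volume.restrict (Set.Ioc 0 (2 * Real.pi)))

/-- `g_k(z) = Log(1 - z^k) - Log(1 - z) - log k`. -/
def gFun (k : ℕ) (z : ℂ) : ℂ :=
  Complex.log (1 - z ^ k) - Complex.log (1 - z) - (Real.log k : ℂ)

/-- `h_k(z) = g_k(z) / (1 - z)`. -/
def hFun (k : ℕ) (z : ℂ) : ℂ := gFun k z / (1 - z)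

/-- The Hardy space `H²`, viewed as the set of elements of `L²(𝕋, m)` whose negative
Fourier coefficients vanish. -/
def H2 : Set (Lp ℂ 2 mCirc) :=
  {f | ∀ n : ℤ, n < 0 → (∫ ω : ℂ, f ω * ω ^ (-n) ∂mCirc) = 0}

end

lemma norm_one_sub_exp_le {u : ℂ} (hu : u.re ≤ 0) : ‖1 - exp u‖ ≤ ‖u‖ := by
  have h := (convex_halfSpace_re_le (0 : ℝ)).norm_image_sub_le_of_norm_deriv_le
    (f := exp) (C := 1) (x := u) (y := 0) (fun x _ => differentiableAt_exp)
    (fun x hx => by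
      rw [Complex.deriv_exp, norm_exp]
      exact Real.exp_le_one_iff.2 hx) hu (by simp)
  simpa using h

lemma eq_one_of_geom_sum_eq {k : ℕ} (hk : 2 ≤ k) {z : ℂ} (hz : ‖z‖ ≤ 1)
    (h : ∑ j ∈ Finset.range k, z ^ j = k) : z = 1 := by
  have hpow (j : ℕ) : (z ^ j).re ≤ 1 :=
    (re_le_norm _).trans (by rw [norm_pow]; exact pow_le_one₀ (norm_nonneg _) hz)
  have hre : ∑ j ∈ Finset.range k, (z ^ j).re = ∑ j ∈ Finset.range k, (1 : ℝ) := by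
    rw [← re_sum, h]
    simp
  have h1 := (Finset.sum_eq_sum_iff_of_le (fun j _ => hpow j)).1 hre 1
    (Finset.mem_range.2 (by omega))
  rw [pow_one] at h1
  have h2 : z.re * z.re + z.im * z.im ≤ 1 := by
    rw [← normSq_apply, normSq_eq_norm_sq]
    exact pow_le_one₀ (norm_nonneg _) hz
  have h3 : z.im = 0 := by
    rw [h1] at h2
    nlinarith [mul_self_nonneg z.im]
  exact Complex.ext (by simpa using h1) (by simpa using h3)

lemma exists_mul_norm_one_sub_le {k : ℕ} (hk : 2 ≤ k) :
    ∃ c : ℝ, 0 < c ∧ ∀ z : ℂ, ‖z‖ ≤ 1 →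
      c * ‖1 - z‖ ≤ ‖1 - (∑ j ∈ Finset.range k, z ^ j) / k‖ := by
  have hk0 : (k : ℂ) ≠ 0 := by exact_mod_cast (by omega : k ≠ 0)
  set q : ℂ → ℂ := fun z => (∑ j ∈ Finset.range k, ∑ i ∈ Finset.range j, z ^ i) / k with hq
  have hfac (z : ℂ) : (1 - z) * q z = 1 - (∑ j ∈ Finset.range k, z ^ j) / k := by
    simp only [hq]
    rw [mul_div_assoc', Finset.mul_sum]
    simp only [mul_neg_geom_sum, Finset.sum_sub_distrib, Finset.sum_const, Finset.card_range,
      nsmul_eq_mul, mul_one, sub_div, div_self hk0]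
  have hne (z : ℂ) (hz : ‖z‖ ≤ 1) : q z ≠ 0 := by
    intro h0
    have h1 := hfac z
    rw [h0, mul_zero, eq_comm, sub_eq_zero, eq_comm, div_eq_one_iff_eq hk0] at h1
    rw [eq_one_of_geom_sum_eq hk hz h1] at h0
    simp only [hq, one_pow, Finset.sum_const, Finset.card_range, nsmul_eq_mul, mul_one,
      div_eq_zero_iff, hk0, or_false] at h0
    rw [← Nat.cast_sum, Nat.cast_eq_zero] at h0
    have h3 := Finset.sum_eq_zero_iff.1 h0 1 (Finset.mem_range.2 (by omega))
    omega
  have hcont : Continuous q := by fun_prop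
  obtain ⟨z₀, hz₀, hmin⟩ := (isCompact_closedBall (0 : ℂ) 1).exists_isMinOn
    ⟨0, by simp⟩ hcont.norm.continuousOn
  refine ⟨‖q z₀‖, norm_pos_iff.2 (hne z₀ (by simpa using hz₀)), fun z hz => ?_⟩
  rw [← hfac, norm_mul, mul_comm]
  gcongr
  exact hmin (by simpa using hz)

lemma exp_gFun {k : ℕ} (hk : 2 ≤ k) {z : ℂ} (hz : z ^ k ≠ 1) :
    exp (gFun k z) = (∑ j ∈ Finset.range k, z ^ j) / k := by
  have hz1 : z ≠ 1 := by
    rintro rfl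
    simp at hz
  have hk0 : (0 : ℝ) < k := by exact_mod_cast (by omega : 0 < k)
  have h1 : 1 - z ≠ 0 := sub_ne_zero.2 hz1.symm
  rw [gFun, exp_sub, exp_sub, exp_log (sub_ne_zero.2 hz.symm), exp_log h1, ← ofReal_exp,
    Real.exp_log hk0, ← mul_neg_geom_sum, mul_div_cancel_left₀ _ h1]
  simp

lemma exists_mul_norm_one_sub_le_norm_gFun {k : ℕ} (hk : 2 ≤ k) :
    ∃ c : ℝ, 0 < c ∧ ∀ z : ℂ, ‖z‖ ≤ 1 → z ^ k ≠ 1 → c * ‖1 - z‖ ≤ ‖gFun k z‖ := by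
  obtain ⟨c, hc, h⟩ := exists_mul_norm_one_sub_le hk
  refine ⟨c, hc, fun z hz hzk => (h z hz).trans ?_⟩
  have hk0 : (0 : ℝ) < k := by exact_mod_cast (by omega : 0 < k)
  rw [← exp_gFun hk hzk]
  apply norm_one_sub_exp_le
  rw [← Real.exp_le_one_iff, ← norm_exp, exp_gFun hk hzk, norm_div, norm_natCast, div_le_one hk0]
  refine (norm_sum_le _ _).trans ((Finset.sum_le_card_nsmul _ _ 1 fun j _ => ?_).trans (by simp))
  rw [norm_pow]
  exact pow_le_one₀ (norm_nonneg _) hz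

lemma pow_ne_one_of_norm_lt_one {k : ℕ} (hk : 2 ≤ k) {z : ℂ} (hz : ‖z‖ < 1) : z ^ k ≠ 1 := by
  intro h
  have h1 : ‖z‖ ^ k = 1 := by rw [← norm_pow, h, norm_one]
  exact (pow_lt_one₀ (norm_nonneg z) hz (by omega)).ne h1

lemma gFun_ne_zero {k : ℕ} (hk : 2 ≤ k) {z : ℂ} (hz : ‖z‖ ≤ 1) (hzk : z ^ k ≠ 1) :
    gFun k z ≠ 0 := by
  obtain ⟨c, hc, h⟩ := exists_mul_norm_one_sub_le_norm_gFun hk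
  have hz1 : 1 - z ≠ 0 := by
    rw [sub_ne_zero]
    rintro rfl
    simp at hzk
  exact norm_pos_iff.1 ((mul_pos hc (norm_pos_iff.2 hz1)).trans_le (h z hz hzk))

lemma norm_inv_hFun_le {k : ℕ} (hk : 2 ≤ k) :
    ∃ C : ℝ, ∀ z : ℂ, ‖z‖ ≤ 1 → z ^ k ≠ 1 → ‖(hFun k z)⁻¹‖ ≤ C := by
  obtain ⟨c, hc, h⟩ := exists_mul_norm_one_sub_le_norm_gFun hk
  refine ⟨c⁻¹, fun z hz hzk => ?_⟩
  rw [hFun, inv_div, norm_div, div_le_iff₀ (norm_pos_iff.2 (gFun_ne_zero hk hz hzk)),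
    inv_mul_eq_div, le_div_iff₀' hc]
  exact h z hz hzk

lemma one_sub_mem_slitPlane {z : ℂ} (hz : ‖z‖ ≤ 1) (hz1 : z ≠ 1) : 1 - z ∈ slitPlane := by
  rw [mem_slitPlane_iff]
  by_contra! h
  simp only [sub_re, one_re, sub_im, one_im] at h
  have h1 := (re_le_norm z).trans hz
  exact hz1 (Complex.ext (by simp; linarith [h.1]) (by simp; linarith [h.2]))

lemma differentiableAt_inv_hFun {k : ℕ} (hk : 2 ≤ k) {z : ℂ} (hz : ‖z‖ ≤ 1) (hzk : z ^ k ≠ 1) :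
    DifferentiableAt ℂ (fun w => (hFun k w)⁻¹) z := by
  have hz1 : z ≠ 1 := by
    rintro rfl
    simp at hzk
  have hs1 := one_sub_mem_slitPlane hz hz1
  have hs2 := one_sub_mem_slitPlane
    (by rw [norm_pow]; exact pow_le_one₀ (norm_nonneg _) hz) hzk
  have hg : DifferentiableAt ℂ (gFun k) z := by
    unfold gFun
    exact ((DifferentiableAt.clog (f := fun w => 1 - w ^ k) (by fun_prop) hs2).sub
      (DifferentiableAt.clog (f := fun w => 1 - w) (by fun_prop) hs1)).sub_const _
  have hg0 := gFun_ne_zero hk hz hzk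
  simp only [hFun, inv_div]
  exact DifferentiableAt.div (by fun_prop) hg hg0

/-- Pairing an `H¹` function with the boundary values of a bounded holomorphic function. -/
lemma integral_mul_eq_zero_of_bounded {μ : Measure ℂ} {G F : ℂ → ℂ} (hG : Integrable G μ)
    (hμ : ∀ᵐ ω ∂μ, ‖ω‖ = 1) (hG0 : ∀ n : ℕ, 1 ≤ n → ∫ ω, G ω * ω ^ n ∂μ = 0)
    (hF : DifferentiableOn ℂ F (Metric.ball 0 1)) {C : ℝ} (hC : ∀ z, ‖z‖ < 1 → ‖F z‖ ≤ C)
    (hFc : ∀ᵐ ω ∂μ, ContinuousAt F ω) {n : ℕ} (hn : 1 ≤ n) :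
    ∫ ω, G ω * F ω * ω ^ n ∂μ = 0 := by
  have hGpow (m : ℕ) : Integrable (fun ω => G ω * ω ^ m) μ := by
    refine hG.mono (hG.1.mul (by fun_prop)) ?_
    filter_upwards [hμ] with ω hω
    simp [hω]
  have hnorm (m : ℕ) : ∫ ω, ‖G ω * ω ^ m‖ ∂μ = ∫ ω, ‖G ω‖ ∂μ := by
    refine integral_congr_ae ?_
    filter_upwards [hμ] with ω hω
    rw [norm_mul, norm_pow, hω, one_pow, mul_one]
  have hdil (r : ℝ) (hr0 : 0 ≤ r) (hr : r < 1) :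
      AEStronglyMeasurable (fun ω => G ω * F (r * ω) * ω ^ n) μ ∧
        ∫ ω, G ω * F (r * ω) * ω ^ n ∂μ = 0 := by
    set a : ℕ → ℂ := fun m => (m.factorial : ℂ)⁻¹ * iteratedDeriv m F 0 with ha
    have hsum (z : ℂ) (hz : ‖z‖ < 1) : HasSum (fun m => a m * z ^ m) (F z) := by
      have := hasSum_taylorSeries_on_ball hF (z := z) (by simpa using hz)
      simp only [sub_zero, smul_eq_mul] at this
      have hterm : (fun m => a m * z ^ m) =
          fun m => (m.factorial : ℂ)⁻¹ * (z ^ m * iteratedDeriv m F 0) := by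
        funext m
        simp only [ha]
        ring
      rwa [hterm]
    have hr' : ‖(r : ℂ)‖ < 1 := by simpa [abs_of_nonneg hr0] using hr
    have hs : HasSum (fun m => ∫ ω, a m * (r : ℂ) ^ m * (G ω * ω ^ (m + n)) ∂μ)
        (∫ ω, ∑' m, a m * (r : ℂ) ^ m * (G ω * ω ^ (m + n)) ∂μ) := by
      refine hasSum_integral_of_summable_integral_norm (fun m => (hGpow _).const_mul _) ?_
      have hrw (m : ℕ) : ∫ ω, ‖a m * (r : ℂ) ^ m * (G ω * ω ^ (m + n))‖ ∂μ
          = ‖a m * (r : ℂ) ^ m‖ * ∫ ω, ‖G ω‖ ∂μ := by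
        rw [← hnorm (m + n), ← integral_const_mul]
        simp only [norm_mul]
      simp only [hrw]
      exact (hsum r hr').summable.norm.mul_right _
    have heq : (fun ω => ∑' m, a m * (r : ℂ) ^ m * (G ω * ω ^ (m + n)))
        =ᵐ[μ] fun ω => G ω * F (r * ω) * ω ^ n := by
      filter_upwards [hμ] with ω hω
      have h1 := ((hsum (r * ω) (by rw [norm_mul, hω, mul_one]; exact hr')).mul_left
        (G ω * ω ^ n)).tsum_eq
      rw [show G ω * F (r * ω) * ω ^ n = G ω * ω ^ n * F (r * ω) by ring, ← h1]
      refine tsum_congr fun m => ?_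
      ring
    constructor
    · have hmem : ∀ᵐ ω ∂μ, ω ∈ Metric.sphere (0 : ℂ) 1 := by simpa using hμ
      have hFr : ContinuousOn (fun ω : ℂ => F (r * ω)) (Metric.sphere 0 1) := by
        refine hF.continuousOn.comp (by fun_prop) fun ω hω => ?_
        rw [mem_sphere_zero_iff_norm] at hω
        rw [mem_ball_zero_iff, norm_mul, hω, mul_one]
        exact hr'
      have hFm := hFr.aestronglyMeasurable (μ := μ) Metric.isClosed_sphere.measurableSet
      rw [Measure.restrict_eq_self_of_ae_mem hmem] at hFm
      exact (hG.1.mul hFm).mul (by fun_prop)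
    · rw [← integral_congr_ae heq, ← hs.tsum_eq]
      have hzero (m : ℕ) : ∫ ω, G ω * ω ^ (m + n) ∂μ = 0 := hG0 _ (by omega)
      simp only [integral_const_mul, hzero, mul_zero, tsum_zero]
  set r : ℕ → ℝ := fun m => 1 - 1 / ((m : ℝ) + 1) with hr
  have hr0 (m : ℕ) : 0 ≤ r m := by
    simp only [hr, sub_nonneg]
    rw [div_le_one (by positivity)]
    linarith [(m.cast_nonneg : (0 : ℝ) ≤ m)]
  have hr1 (m : ℕ) : r m < 1 := by
    simp only [hr]
    linarith [Nat.one_div_pos_of_nat (α := ℝ) (n := m)]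
  have hlim : Filter.Tendsto r Filter.atTop (nhds 1) := by
    simpa [hr] using (tendsto_one_div_add_atTop_nhds_zero_nat (𝕜 := ℝ)).const_sub 1
  have key := tendsto_integral_of_dominated_convergence (μ := μ)
    (F := fun m ω => G ω * F (r m * ω) * ω ^ n) (f := fun ω => G ω * F ω * ω ^ n)
    (fun ω => ‖G ω‖ * C) (fun m => (hdil _ (hr0 m) (hr1 m)).1) (hG.norm.mul_const C)
    (fun m => by
      filter_upwards [hμ] with ω hω
      rw [norm_mul, norm_mul, norm_pow, hω, one_pow, mul_one]
      gcongr
      apply hC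
      rw [norm_mul, hω, mul_one, norm_real, Real.norm_of_nonneg (hr0 m)]
      exact hr1 m)
    (by
      filter_upwards [hFc] with ω hω
      refine (Filter.Tendsto.const_mul _ (hω.tendsto.comp ?_)).mul_const _
      have h2 : Filter.Tendsto (fun m => (r m : ℂ)) Filter.atTop (nhds ((1 : ℝ) : ℂ)) :=
        (continuous_ofReal.tendsto 1).comp hlim
      simpa using h2.mul_const ω)
  simp only [(hdil _ (hr0 _) (hr1 _)).2] at key
  exact tendsto_nhds_unique key tendsto_const_nhds

section AddCircle

open AddCircle

variable {T : ℝ} [Fact (0 < T)]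

lemma AddCircle.measure_ext_of_integral_fourier {μ ν : Measure (AddCircle T)} [IsFiniteMeasure μ]
    [IsFiniteMeasure ν] (h : ∀ n : ℤ, ∫ x, fourier n x ∂μ = ∫ x, fourier n x ∂ν) : μ = ν := by
  have hint (μ : Measure (AddCircle T)) [IsFiniteMeasure μ] (f : C(AddCircle T, ℂ)) :
      Integrable f μ := f.continuous.integrable_of_hasCompactSupport
        (HasCompactSupport.of_compactSpace _)
  have hcont (μ : Measure (AddCircle T)) [IsFiniteMeasure μ] :
      Continuous fun f : C(AddCircle T, ℂ) => ∫ x, f x ∂μ := by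
    refine (continuous_integral.comp (ContinuousMap.toLp 1 μ ℂ).continuous).congr fun f => ?_
    exact integral_congr_ae (ContinuousMap.coeFn_toLp μ f)
  have hall (f : C(AddCircle T, ℂ)) : ∫ x, f x ∂μ = ∫ x, f x ∂ν := by
    have hf : f ∈ (Submodule.span ℂ (Set.range <| @fourier T)).topologicalClosure := by
      rw [span_fourier_closure_eq_top]
      trivial
    refine closure_minimal (fun g hg => ?_) (isClosed_eq (hcont μ) (hcont ν)) hf
    induction hg using Submodule.span_induction with
    | mem g hg =>
      obtain ⟨n, rfl⟩ := hg
      exact h n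
    | zero => simp
    | add f g _ _ hf hg =>
      simp only [Set.mem_ofPred_eq, ContinuousMap.add_apply] at hf hg ⊢
      rw [integral_add (hint _ f) (hint _ g), integral_add (hint _ f) (hint _ g), hf, hg]
    | smul c f _ hf =>
      simp only [Set.mem_ofPred_eq, ContinuousMap.smul_apply] at hf ⊢
      rw [integral_smul, integral_smul, hf]
  refine ext_of_forall_integral_eq_of_IsFiniteMeasure fun f => ?_
  have := hall ⟨fun x => (f x : ℂ), by fun_prop⟩
  simp only [ContinuousMap.coe_mk, integral_complex_ofReal] at this
  exact_mod_cast this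

/-- A nonnegative integrable function whose Fourier coefficients of nonzero index vanish is
constant. -/
lemma AddCircle.ae_eq_const_of_fourierCoeff_eq_zero {f : AddCircle T → ℝ}
    (hf0 : ∀ x, 0 ≤ f x) (hfi : Integrable f haarAddCircle)
    (hf : ∀ n : ℤ, n ≠ 0 → fourierCoeff (fun x => (f x : ℂ)) n = 0) :
    ∃ lam : ℝ, 0 ≤ lam ∧ ∀ᵐ x ∂(haarAddCircle (T := T)), f x = lam := by
  set lam : ℝ := ∫ x, f x ∂haarAddCircle with hlam
  have hlam0 : 0 ≤ lam := integral_nonneg hf0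
  have hfin : ∫⁻ x, ENNReal.ofReal (f x) ∂haarAddCircle ≠ ⊤ := hfi.lintegral_lt_top.ne
  have : IsFiniteMeasure ((haarAddCircle (T := T)).withDensity fun x => ENNReal.ofReal (f x)) :=
    isFiniteMeasure_withDensity hfin
  have : IsFiniteMeasure ((haarAddCircle (T := T)).withDensity fun _ => ENNReal.ofReal lam) :=
    isFiniteMeasure_withDensity (by simp)
  have heq : (haarAddCircle (T := T)).withDensity (fun x => ENNReal.ofReal (f x)) =
      (haarAddCircle (T := T)).withDensity fun _ => ENNReal.ofReal lam := by
    refine measure_ext_of_integral_fourier fun n => ?_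
    rw [integral_withDensity_eq_integral_toReal_smul₀ hfi.1.aemeasurable.ennreal_ofReal
      (by simp), integral_withDensity_eq_integral_toReal_smul₀ (by fun_prop) (by simp)]
    simp only [ENNReal.toReal_ofReal (hf0 _), ENNReal.toReal_ofReal hlam0]
    rw [integral_smul]
    have h1 : ∫ x, f x • fourier n x ∂haarAddCircle = fourierCoeff (fun x => (f x : ℂ)) (-n) := by
      simp [fourierCoeff, mul_comm]
    have h2 : ∫ x : AddCircle T, fourier n x ∂haarAddCircle = fourierCoeff (fourier 0 : C(AddCircle T, ℂ)) (-n) := by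
      simp [fourierCoeff]
    rw [h1, h2, fourierCoeff_fourier]
    rcases eq_or_ne n 0 with rfl | hn
    · simp [fourierCoeff, hlam, integral_complex_ofReal]
    · rw [hf _ (neg_ne_zero.2 hn), Pi.single_eq_of_ne (neg_ne_zero.2 hn), smul_zero]
  refine ⟨lam, hlam0, ?_⟩
  filter_upwards [(withDensity_eq_iff hfi.1.aemeasurable.ennreal_ofReal (by fun_prop) hfin).1 heq]
    with x hx
  exact (ENNReal.ofReal_eq_ofReal_iff (hf0 x) hlam0).1 hx

end AddCircle

instance : Fact (0 < 2 * Real.pi) := ⟨Real.two_pi_pos⟩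

lemma mCirc_eq_map : mCirc =
    Measure.map (fun x : AddCircle (2 * Real.pi) => (AddCircle.toCircle x : ℂ))
      AddCircle.haarAddCircle := by
  have hmeas : Measurable fun x : AddCircle (2 * Real.pi) => (AddCircle.toCircle x : ℂ) :=
    (continuous_subtype_val.comp AddCircle.continuous_toCircle).measurable
  have hT0 : ENNReal.ofReal (2 * Real.pi) ≠ 0 := by
    simpa using Real.pi_pos
  have h : (AddCircle.haarAddCircle : Measure (AddCircle (2 * Real.pi))) =
      (ENNReal.ofReal (2 * Real.pi))⁻¹ • volume := by
    rw [AddCircle.volume_eq_smul_haarAddCircle, smul_smul,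
      ENNReal.inv_mul_cancel hT0 ENNReal.ofReal_ne_top, one_smul]
  have hmk := AddCircle.measurePreserving_mk (2 * Real.pi) 0
  rw [zero_add] at hmk
  rw [h, Measure.map_smul, ← hmk.map_eq, Measure.map_map hmeas hmk.measurable, mCirc]
  congr 2
  ext θ
  simp [AddCircle.toCircle_apply_mk, Circle.coe_exp, Real.pi_ne_zero]

lemma measurableEmbedding_toCircle :
    MeasurableEmbedding fun x : AddCircle (2 * Real.pi) => (AddCircle.toCircle x : ℂ) :=
  ((continuous_subtype_val.comp AddCircle.continuous_toCircle).isClosedEmbedding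
    (Subtype.val_injective.comp (AddCircle.injective_toCircle Real.two_pi_pos.ne'))
    ).measurableEmbedding

lemma ae_mCirc_iff {p : ℂ → Prop} : (∀ᵐ ω ∂mCirc, p ω) ↔
    ∀ᵐ x : AddCircle (2 * Real.pi) ∂AddCircle.haarAddCircle, p (AddCircle.toCircle x) := by
  rw [mCirc_eq_map, measurableEmbedding_toCircle.ae_map_iff]

lemma ae_norm_eq_one : ∀ᵐ ω ∂mCirc, ‖ω‖ = 1 :=
  ae_mCirc_iff.2 (.of_forall fun _ => Circle.norm_coe _)

lemma ae_pow_ne_one {k : ℕ} (hk : k ≠ 0) : ∀ᵐ ω ∂mCirc, ω ^ k ≠ 1 := by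
  have hfin : {ω : ℂ | ω ^ k = 1}.Finite := by
    refine (Polynomial.nthRoots k (1 : ℂ)).toFinset.finite_toSet.subset fun ω hω => ?_
    simpa [Polynomial.mem_nthRoots (Nat.pos_of_ne_zero hk)] using hω
  rw [ae_mCirc_iff, ae_iff]
  simp only [not_not]
  have : Nontrivial (Set.Ioc (0 : ℝ) (0 + 2 * Real.pi)) :=
    Set.nontrivial_coe_sort.2 (Set.Ioc_infinite (by simpa using Real.pi_pos)).nontrivial
  have : Nontrivial (AddCircle (2 * Real.pi)) :=
    (AddCircle.equivIoc (2 * Real.pi) 0).symm.injective.nontrivial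
  exact (hfin.preimage measurableEmbedding_toCircle.injective.injOn).measure_zero _

lemma ae_eq_const_of_integral_mul_pow_eq_zero {ρ : ℂ → ℝ} (hρ0 : ∀ ω, 0 ≤ ρ ω)
    (hρ : Integrable ρ mCirc) (h : ∀ n : ℕ, 1 ≤ n → ∫ ω, (ρ ω : ℂ) * ω ^ n ∂mCirc = 0) :
    ∃ lam : ℝ, 0 ≤ lam ∧ ∀ᵐ ω ∂mCirc, ρ ω = lam := by
  simp only [ae_mCirc_iff]
  rw [mCirc_eq_map, measurableEmbedding_toCircle.integrable_map_iff] at hρ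
  have hneg (n : ℕ) (hn : 1 ≤ n) :
      fourierCoeff (fun x : AddCircle (2 * Real.pi) => (ρ (AddCircle.toCircle x) : ℂ)) (-n) = 0 := by
    rw [← h n hn, mCirc_eq_map, measurableEmbedding_toCircle.integral_map, fourierCoeff]
    refine integral_congr_ae (.of_forall fun x => ?_)
    simp [fourier_apply, AddCircle.toCircle_nsmul, mul_comm]
  refine AddCircle.ae_eq_const_of_fourierCoeff_eq_zero (fun x => hρ0 _) hρ fun n hn => ?_
  rcases lt_or_gt_of_ne hn with hn | hn
  · obtain ⟨m, rfl⟩ := Int.exists_eq_neg_ofNat hn.le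
    exact hneg m (by omega)
  · lift n to ℕ using hn.le
    have h1 := congrArg (starRingEnd ℂ) (hneg n (by omega))
    rw [fourierCoeff, ← integral_conj, map_zero] at h1
    rw [← h1, fourierCoeff]
    refine integral_congr_ae (.of_forall fun x => ?_)
    simp only [smul_eq_mul, map_mul, conj_ofReal, ← fourier_neg, neg_neg]

/-- Each `h_k` (`k ≥ 2`) is a rigid function of `H¹`: any `G ∈ H¹(𝕋)`
having the same argument as `h_k` a.e. (i.e. `G = ρ·h_k` a.e. for some measurable
`ρ : 𝕋 → [0, ∞)`) is a nonnegative constant multiple of `h_k`. -/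
theorem hk_rigid (k : ℕ) (hk2 : 2 ≤ k)
    (G : Lp ℂ 1 mCirc)
    -- `G ∈ H¹`: negative Fourier coefficients vanish
    (hGH1 : ∀ n : ℤ, n < 0 → (∫ ω : ℂ, G ω * ω ^ (-n) ∂mCirc) = 0)
    -- `G` has the same argument as `h_k` a.e.
    (ρ : ℂ → ℝ) (hρ_meas : Measurable ρ) (hρ_nonneg : ∀ ω, 0 ≤ ρ ω)
    (hGρ : (G : ℂ → ℂ) =ᵐ[mCirc] fun ω => (ρ ω : ℂ) * hFun k ω) :
    ∃ lam : ℝ, 0 ≤ lam ∧ (G : ℂ → ℂ) =ᵐ[mCirc] fun ω => (lam : ℂ) * hFun k ω := by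
  have hnorm := ae_norm_eq_one
  have hpow := ae_pow_ne_one (k := k) (by omega)
  obtain ⟨C, hC⟩ := norm_inv_hFun_le hk2
  have hG : Integrable G mCirc := L1.integrable_coeFn G
  have hρG : (fun ω => (ρ ω : ℂ)) =ᵐ[mCirc] fun ω => G ω * (hFun k ω)⁻¹ := by
    filter_upwards [hGρ, hnorm, hpow] with ω h1 h2 h3
    have h4 : hFun k ω ≠ 0 := by
      refine div_ne_zero (gFun_ne_zero hk2 h2.le h3) (sub_ne_zero.2 ?_)
      rintro rfl
      simp at h3
    rw [h1, mul_inv_cancel_right₀ h4]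
  have hρint : Integrable ρ mCirc := by
    refine (hG.norm.mul_const C).mono' hρ_meas.aestronglyMeasurable ?_
    filter_upwards [hρG, hnorm, hpow] with ω h1 h2 h3
    rw [← norm_real, h1, norm_mul]
    gcongr
    exact hC ω h2.le h3
  obtain ⟨lam, hlam, hρlam⟩ := ae_eq_const_of_integral_mul_pow_eq_zero hρ_nonneg hρint
    fun n hn => by
      rw [← integral_mul_eq_zero_of_bounded (F := fun ω => (hFun k ω)⁻¹) hG hnorm
        (fun m hm => by simpa using hGH1 (-m) (by omega))
        (fun z hz => (differentiableAt_inv_hFun hk2 (mem_ball_zero_iff.1 hz).le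
          (pow_ne_one_of_norm_lt_one hk2 (mem_ball_zero_iff.1 hz))).differentiableWithinAt)
        (fun z hz => hC z hz.le (pow_ne_one_of_norm_lt_one hk2 hz))
        (by
          filter_upwards [hnorm, hpow] with ω h2 h3
          exact (differentiableAt_inv_hFun hk2 h2.le h3).continuousAt) hn]
      refine integral_congr_ae ?_
      filter_upwards [hρG] with ω h1
      rw [h1]
  refine ⟨lam, hlam, ?_⟩
  filter_upwards [hGρ, hρlam] with ω h1 h2
  rw [h1, h2]
end

section
/- Suppose f ∈ H² and there exist constants C > 0 and c > 0 such that |f̂(n)| ≤ C·e^{−c√n} for all integers n ≥ 0. If ∫_𝕋 h_k(ω)·conj(f(ω)) dm(ω) = 0 for every k ≥ 2, then f = 0 (m-almost everywhere). That is, 𝒩^⊥ contains no non-trivial function whose Taylor coefficients satisfy f̂(n) = O(e^{−c√n}). -/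
open MeasureTheory Complex

open Filter Topology Finset

/-- Partial sums of `∑ zⁿ / n` converge on the unit circle away from `1`. -/
theorem tendsto_sum_pow_div_nat_neg_log {z : ℂ} (hz : ‖z‖ = 1) (hz1 : z ≠ 1) :
    Tendsto (fun N : ℕ => ∑ n ∈ range N, z ^ n / n) atTop (𝓝 (-log (1 - z))) := by
  have hsub : (1 : ℂ) - z ≠ 0 := sub_ne_zero.mpr hz1.symm
  have hre : z.re < 1 := by
    refine lt_of_le_of_ne (hz ▸ Complex.re_le_norm z) fun h => hz1 ?_
    have h2 := Complex.sq_norm_sub_sq_re z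
    rw [hz, h] at h2
    apply Complex.ext h
    simpa using h2.symm
  have hcauchy : CauchySeq fun N : ℕ => ∑ n ∈ range N, (1 / ((n : ℝ) + 1)) • z ^ (n + 1) := by
    refine Antitone.cauchySeq_series_mul_of_tendsto_zero_of_bounded (b := 2 / ‖z - 1‖)
      (fun m n hmn => ?_) tendsto_one_div_add_atTop_nhds_zero_nat fun n => ?_
    · have : (m : ℝ) ≤ n := by exact_mod_cast hmn
      change 1 / ((n : ℝ) + 1) ≤ 1 / ((m : ℝ) + 1)
      gcongr
    · simp_rw [pow_succ, ← Finset.sum_mul]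
      rw [geom_sum_eq hz1, norm_mul, hz, mul_one, norm_div]
      gcongr
      calc ‖z ^ n - 1‖ ≤ ‖z ^ n‖ + ‖(1 : ℂ)‖ := norm_sub_le _ _
        _ = 2 := by rw [norm_pow, hz]; norm_num
  obtain ⟨l, hl⟩ := cauchySeq_tendsto_of_complete hcauchy
  have hl' : Tendsto (fun N : ℕ => ∑ n ∈ range N, z ^ n / n) atTop (𝓝 l) := by
    rw [← tendsto_add_atTop_iff_nat 1]
    refine hl.congr fun N => ?_
    rw [Finset.sum_range_succ']
    simp only [Nat.cast_zero, div_zero, add_zero]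
    refine Finset.sum_congr rfl fun n _ => ?_
    rw [Complex.real_smul]
    push_cast
    ring
  have habel := Complex.tendsto_tsum_powerSeries_nhdsWithin_lt hl'
  rw [tendsto_map'_iff] at habel
  have hlog : Tendsto (fun r : ℝ => -log (1 - r * z)) (𝓝[<] 1) (𝓝 (-log (1 - z))) := by
    have hslit : (1 : ℂ) - (1 : ℝ) * z ∈ slitPlane := by
      left
      simpa using hre
    have : ContinuousAt (fun r : ℝ => -log (1 - r * z)) 1 :=
      (ContinuousAt.clog (f := fun r : ℝ => 1 - (r : ℂ) * z) (by fun_prop) hslit).neg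
    simpa using this.tendsto.mono_left nhdsWithin_le_nhds
  have heq : l = -log (1 - z) := by
    refine tendsto_nhds_unique (habel.congr' ?_) hlog
    have h0 : ∀ᶠ r : ℝ in 𝓝[<] 1, 0 < r :=
      nhdsWithin_le_nhds (lt_mem_nhds one_pos)
    filter_upwards [h0, self_mem_nhdsWithin] with r hr0 hr1
    have hrz : ‖(r : ℂ) * z‖ < 1 := by
      rw [norm_mul, hz, mul_one, Complex.norm_real, Real.norm_of_nonneg hr0.le]
      exact hr1
    rw [← (hasSum_taylorSeries_neg_log hrz).tsum_eq]
    refine tsum_congr fun n => ?_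
    rw [mul_pow]
    ring
  exact heq ▸ hl'

/-- The `n`-th Taylor coefficient of `h_k`. -/
noncomputable def hCoeff (k n : ℕ) : ℝ := harmonic n - harmonic (n / k) - Real.log k

theorem one_sub_mul_sum_hCoeff {k : ℕ} (hk : 0 < k) (z : ℂ) (N : ℕ) :
    (1 - z) * ∑ n ∈ range N, (hCoeff k n : ℂ) * z ^ n =
      ∑ n ∈ range (N + 1), z ^ n / n - ∑ n ∈ range (N / k + 1), (z ^ k) ^ n / n
        - Real.log k - hCoeff k N * z ^ N := by
  induction N with
  | zero => simp [hCoeff]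
  | succ N ih =>
    rw [Finset.sum_range_succ, mul_add, ih, Finset.sum_range_succ _ (N + 1), Nat.succ_div]
    have hN : ((N : ℂ) + 1) ≠ 0 := by exact_mod_cast N.succ_ne_zero
    split_ifs with hdvd
    · have hq : k * (N / k + 1) = N + 1 := by
        have := Nat.mul_div_cancel' hdvd
        rwa [Nat.succ_div, if_pos hdvd] at this
      have hk' : (k : ℂ) ≠ 0 := by exact_mod_cast hk.ne'
      have hqC : (k : ℂ) * ((N / k : ℕ) + 1) = N + 1 := by exact_mod_cast hq
      have hq0 : (((N / k : ℕ) : ℂ) + 1) ≠ 0 := by exact_mod_cast (N / k).succ_ne_zero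
      rw [Finset.sum_range_succ _ (N / k + 1), ← pow_mul, hq]
      simp only [hCoeff, Nat.succ_div, if_pos hdvd, harmonic_succ]
      push_cast
      field_simp
      ring
    · rw [add_zero]
      simp only [hCoeff, Nat.succ_div, if_neg hdvd, harmonic_succ, add_zero]
      push_cast
      field_simp
      ring

theorem abs_harmonic_sub_log_sub_le {n : ℕ} (hn : 0 < n) :
    |(harmonic n : ℝ) - Real.log n - Real.eulerMascheroniConstant| ≤ 1 / n := by
  have h1 := Real.eulerMascheroniSeq_lt_eulerMascheroniConstant n
  have h2 := Real.eulerMascheroniConstant_lt_eulerMascheroniSeq' n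
  rw [Real.eulerMascheroniSeq] at h1
  rw [Real.eulerMascheroniSeq', if_neg hn.ne'] at h2
  have hn' : (0 : ℝ) < n := by exact_mod_cast hn
  have h3 : Real.log (n + 1) - Real.log n ≤ 1 / n := by
    rw [← Real.log_div (by positivity) hn'.ne']
    refine (Real.log_le_sub_one_of_pos (by positivity)).trans (le_of_eq ?_)
    field_simp
    ring
  rw [abs_le]
  constructor <;> linarith [one_div_pos.mpr hn']

theorem abs_hCoeff_le {k n : ℕ} (hk : 0 < k) (hn : k ≤ n) : |hCoeff k n| ≤ 6 * k / n := by
  have hq : 0 < n / k := Nat.div_pos hn hk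
  have hn0 : 0 < n := hk.trans_le hn
  set q := n / k with hqdef
  have hkq : k * q ≤ n := Nat.mul_div_le n k
  have hnq : n < k * (q + 1) := Nat.lt_mul_div_succ n hk
  have hk' : (0 : ℝ) < k := by exact_mod_cast hk
  have hq' : (0 : ℝ) < q := by exact_mod_cast hq
  have hn' : (0 : ℝ) < n := by exact_mod_cast hn0
  have hkq' : (k : ℝ) * q ≤ n := by exact_mod_cast hkq
  have hnq' : (n : ℝ) ≤ k * (q + 1) := by exact_mod_cast hnq.le
  have hlog0 : 0 ≤ Real.log n - Real.log q - Real.log k := by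
    have := Real.log_le_log (by positivity) hkq'
    rw [Real.log_mul hk'.ne' hq'.ne'] at this
    linarith
  have hlog1 : Real.log n - Real.log q - Real.log k ≤ 1 / q := by
    have h1 := Real.log_le_log hn' hnq'
    rw [Real.log_mul hk'.ne' (by positivity)] at h1
    have h3 : Real.log (q + 1) - Real.log q ≤ 1 / q := by
      rw [← Real.log_div (by positivity) hq'.ne']
      refine (Real.log_le_sub_one_of_pos (by positivity)).trans (le_of_eq ?_)
      field_simp
      ring
    linarith
  have h1 := abs_le.mp (abs_harmonic_sub_log_sub_le hn0)
  have h2 := abs_le.mp (abs_harmonic_sub_log_sub_le hq)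
  have hqn : 1 / (q : ℝ) ≤ 2 * k / n := by
    rw [div_le_div_iff₀ hq' hn']
    have : (1 : ℝ) ≤ q := by exact_mod_cast hq
    nlinarith
  have hnk : 1 / (n : ℝ) ≤ 2 * k / n := by
    gcongr
    have : (1 : ℝ) ≤ k := by exact_mod_cast hk
    linarith
  have h6 : 6 * (k : ℝ) / n = 3 * (2 * k / n) := by ring
  rw [hCoeff, ← hqdef, h6, abs_le]
  constructor <;> linarith

theorem tendsto_hCoeff {k : ℕ} (hk : 0 < k) : Tendsto (hCoeff k) atTop (𝓝 0) := by
  refine squeeze_zero_norm' ?_ (tendsto_const_div_atTop_nhds_zero_nat (6 * (k : ℝ)))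
  filter_upwards [eventually_ge_atTop k] with n hn using abs_hCoeff_le hk hn

theorem summable_hCoeff_sq {k : ℕ} (hk : 0 < k) : Summable fun n => hCoeff k n ^ 2 := by
  have h : Summable fun n : ℕ => (6 * (k : ℝ)) ^ 2 * (1 / (n : ℝ) ^ 2) :=
    (Real.summable_one_div_nat_pow.mpr one_lt_two).mul_left _
  refine h.of_norm_bounded_eventually_nat ?_
  filter_upwards [eventually_ge_atTop k] with n hn
  rw [norm_pow, Real.norm_eq_abs, ← div_eq_mul_one_div, ← div_pow]
  exact pow_le_pow_left₀ (abs_nonneg _) (abs_hCoeff_le hk hn) 2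

theorem abs_harmonic_le (n : ℕ) : |(harmonic n : ℝ)| ≤ n := by
  induction n with
  | zero => simp
  | succ n ih =>
    rw [harmonic_succ]
    push_cast
    refine (abs_add_le _ _).trans (add_le_add ih ?_)
    rw [abs_of_nonneg (by positivity)]
    exact inv_le_one_of_one_le₀ (by linarith [n.cast_nonneg (α := ℝ)])

open ArithmeticFunction in
theorem sum_moebius_div_mul_harmonic (q : ℕ) {M : ℕ} (hM : q ≤ M) :
    ∑ m ∈ Icc 1 M, (moebius m : ℝ) / m * harmonic (q / m) = if 1 ≤ q then 1 else 0 := by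
  induction q with
  | zero => simp
  | succ q ih =>
    have hstep : ∀ m ∈ Icc 1 M, (moebius m : ℝ) / m * harmonic ((q + 1) / m) =
        (moebius m : ℝ) / m * harmonic (q / m) +
          (if m ∣ q + 1 then (moebius m : ℝ) else 0) * (1 / ((q : ℝ) + 1)) := by
      intro m hm
      have hm0 : (m : ℝ) ≠ 0 := by
        have := (Finset.mem_Icc.mp hm).1
        exact_mod_cast (by lia : m ≠ 0)
      have hq0 : (q : ℝ) + 1 ≠ 0 := by positivity
      rw [Nat.succ_div]
      split_ifs with hd
      · have hq : m * (q / m + 1) = q + 1 := by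
          have := Nat.mul_div_cancel' hd
          rwa [Nat.succ_div, if_pos hd] at this
        have hqR : (m : ℝ) * ((q / m : ℕ) + 1) = q + 1 := by exact_mod_cast hq
        have hqm : ((q / m : ℕ) : ℝ) + 1 ≠ 0 := by positivity
        rw [harmonic_succ, ← hqR]
        push_cast
        field_simp
      · simp
    rw [Finset.sum_congr rfl hstep, Finset.sum_add_distrib, ih (by lia), ← Finset.sum_mul,
      ← Finset.sum_filter]
    have hdiv : (Icc 1 M).filter (· ∣ q + 1) = (q + 1).divisors := by
      ext m
      simp only [Finset.mem_filter, Finset.mem_Icc, Nat.mem_divisors]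
      constructor
      · rintro ⟨_, h⟩
        exact ⟨h, by lia⟩
      · rintro ⟨h, _⟩
        exact ⟨⟨Nat.pos_of_dvd_of_pos h q.succ_pos, (Nat.le_of_dvd q.succ_pos h).trans hM⟩, h⟩
    have hmu : ∑ m ∈ (q + 1).divisors, (moebius m : ℝ) = if q + 1 = 1 then 1 else 0 := by
      have h := congrArg (fun F : ArithmeticFunction ℤ => F (q + 1)) moebius_mul_coe_zeta
      simp only [coe_mul_zeta_apply, ArithmeticFunction.one_apply] at h
      exact_mod_cast h
    rw [hdiv, hmu]
    rcases q with _ | q <;> simp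

theorem summable_mul_of_quadratic_bound {a : ℕ → ℂ}
    (ha : Summable fun n : ℕ => ‖a n‖ * ((n : ℝ) + 1) ^ 2)
    {w : ℕ → ℂ} (hw : ∀ n : ℕ, ‖w n‖ ≤ ((n : ℝ) + 1) ^ 2) :
    Summable fun n => w n * a n := by
  refine ha.of_norm_bounded fun n => ?_
  rw [norm_mul, mul_comm]
  exact mul_le_mul_of_nonneg_left (hw n) (norm_nonneg _)

theorem eq_zero_of_tsum_harmonic_div_eq_zero {a : ℕ → ℂ}
    (ha : Summable fun n : ℕ => ‖a n‖ * ((n : ℝ) + 1) ^ 2)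
    (h0 : ∑' n, a n = 0)
    (h : ∀ k, 1 ≤ k → ∑' n, (harmonic (n / k) : ℂ) * a n = 0) (n : ℕ) : a n = 0 := by
  have hharm : ∀ k n : ℕ, ‖(harmonic (n / k) : ℂ)‖ ≤ n := fun k n => by
    have h1 : ‖(harmonic (n / k) : ℂ)‖ = |(harmonic (n / k) : ℝ)| := by
      rw [← Real.norm_eq_abs, ← Complex.norm_real, Complex.ofReal_ratCast]
    rw [h1]
    exact (abs_harmonic_le _).trans (by exact_mod_cast Nat.div_le_self n k)
  have hsum : ∀ k, Summable fun n => (harmonic (n / k) : ℂ) * a n := fun k =>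
    summable_mul_of_quadratic_bound ha fun n =>
      (hharm k n).trans (by nlinarith [n.cast_nonneg (α := ℝ)])
  have htail : ∀ k, ∑' n, (if k ≤ n then 1 else 0) * a n = 0 := by
    intro k
    rcases Nat.eq_zero_or_pos k with rfl | hk
    · simpa using h0
    let T : ℕ → ℕ → ℂ := fun M n =>
      ∑ m ∈ Icc 1 M, (ArithmeticFunction.moebius m : ℂ) / m * harmonic (n / k / m)
    have hT : ∀ M n, n ≤ M → T M n = if k ≤ n then 1 else 0 := fun M n hM => by
      have h1 := congrArg (Complex.ofReal)
        (sum_moebius_div_mul_harmonic (n / k) ((Nat.div_le_self n k).trans hM))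
      simp only [Nat.one_le_div_iff hk] at h1
      push_cast at h1
      rw [apply_ite Complex.ofReal, Complex.ofReal_one, Complex.ofReal_zero] at h1
      exact h1
    have hTzero : ∀ M, ∑' n, T M n * a n = 0 := fun M => by
      have h1 : ∀ m ∈ Icc 1 M, HasSum (fun n =>
          (ArithmeticFunction.moebius m : ℂ) / m * (harmonic (n / k / m) * a n)) 0 := by
        intro m hm
        have hkm : 1 ≤ k * m := Nat.mul_pos hk (Finset.mem_Icc.mp hm).1
        have h2 := ((hsum (k * m)).hasSum.mul_left ((ArithmeticFunction.moebius m : ℂ) / m))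
        rw [h _ hkm, mul_zero] at h2
        simpa only [Nat.div_div_eq_div_mul] using h2
      have h2 := hasSum_sum h1
      rw [Finset.sum_const_zero] at h2
      rw [← h2.tsum_eq]
      simp only [T, Finset.sum_mul, mul_assoc]
    have hTbound : ∀ M n, ‖T M n‖ ≤ ((n : ℝ) + 1) ^ 2 := fun M n => by
      have hle : T M n = T (min M n) n := by
        refine (Finset.sum_subset (Finset.Icc_subset_Icc_right (min_le_left M n)) ?_).symm
        intro m hm hm'
        have : n < m := by
          simp only [Finset.mem_Icc] at hm hm'
          lia
        rw [Nat.div_eq_of_lt ((Nat.div_le_self n k).trans_lt this)]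
        simp
      rw [hle]
      refine (norm_sum_le _ _).trans ?_
      have hterm : ∀ m ∈ Icc 1 (min M n),
          ‖(ArithmeticFunction.moebius m : ℂ) / m * harmonic (n / k / m)‖ ≤ n := by
        intro m hm
        rw [norm_mul, Nat.div_div_eq_div_mul]
        have hm1 : (1 : ℝ) ≤ m := by exact_mod_cast (Finset.mem_Icc.mp hm).1
        have hmu : ‖(ArithmeticFunction.moebius m : ℂ)‖ ≤ 1 := by
          rw [Complex.norm_intCast]
          exact_mod_cast ArithmeticFunction.abs_moebius_le_one
        have : ‖(ArithmeticFunction.moebius m : ℂ) / m‖ ≤ 1 := by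
          rw [norm_div, Complex.norm_natCast]
          exact div_le_one_of_le₀ (hmu.trans hm1) (by positivity)
        simpa using mul_le_mul this (hharm (k * m) n) (norm_nonneg _) zero_le_one
      refine (Finset.sum_le_card_nsmul _ _ _ hterm).trans ?_
      have : ((min M n : ℕ) : ℝ) ≤ n := by exact_mod_cast min_le_right M n
      simp only [Nat.card_Icc, add_tsub_cancel_right, nsmul_eq_mul]
      nlinarith [n.cast_nonneg (α := ℝ)]
    have hlim : Tendsto (fun M => ∑' n, T M n * a n) atTop
        (𝓝 (∑' n, (if k ≤ n then 1 else 0) * a n)) := by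
      refine tendsto_tsum_of_dominated_convergence ha (fun n => ?_)
        (Eventually.of_forall fun M n => ?_)
      · refine tendsto_const_nhds.congr' ?_
        filter_upwards [eventually_ge_atTop n] with M hM
        rw [hT M n hM]
      · rw [norm_mul, mul_comm]
        exact mul_le_mul_of_nonneg_left (hTbound M n) (norm_nonneg _)
    simp only [hTzero] at hlim
    exact tendsto_nhds_unique hlim tendsto_const_nhds |>.symm ▸ rfl
  have hsumtail : ∀ k, Summable fun n => (if k ≤ n then (1 : ℂ) else 0) * a n := fun k =>
    summable_mul_of_quadratic_bound ha fun n => by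
      have h1 : (1 : ℝ) ≤ ((n : ℝ) + 1) ^ 2 := one_le_pow₀ (by linarith [n.cast_nonneg (α := ℝ)])
      split_ifs
      · simpa only [norm_one] using h1
      · simpa only [norm_zero] using zero_le_one.trans h1
  have hdiff := (hsumtail n).tsum_sub (hsumtail (n + 1))
  rw [htail, htail, sub_zero, tsum_eq_single n] at hdiff
  · simpa using hdiff
  · intro m hm
    rcases lt_or_gt_of_ne hm with h1 | h1
    · simp [show ¬ n ≤ m by lia, show ¬ n + 1 ≤ m by lia]
    · simp [show n ≤ m by lia, show n + 1 ≤ m by lia]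

theorem eq_zero_of_tsum_hCoeff_eq_zero {a : ℕ → ℂ}
    (ha : Summable fun n : ℕ => ‖a n‖ * ((n : ℝ) + 1) ^ 2)
    (h : ∀ k, 2 ≤ k → ∑' n, (hCoeff k n : ℂ) * a n = 0) (n : ℕ) : a n = 0 := by
  have hharm : ∀ k n : ℕ, ‖(harmonic (n / k) : ℂ)‖ ≤ ((n : ℝ) + 1) ^ 2 := fun k n => by
    have h1 : ‖(harmonic (n / k) : ℂ)‖ = |(harmonic (n / k) : ℝ)| := by
      rw [← Real.norm_eq_abs, ← Complex.norm_real, Complex.ofReal_ratCast]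
    rw [h1]
    have h2 : ((n / k : ℕ) : ℝ) ≤ n := by exact_mod_cast Nat.div_le_self n k
    nlinarith [abs_harmonic_le (n / k), n.cast_nonneg (α := ℝ)]
  have hsum : ∀ k, Summable fun n => (harmonic (n / k) : ℂ) * a n := fun k =>
    summable_mul_of_quadratic_bound ha (hharm k)
  have hsum1 : Summable fun n => (harmonic n : ℂ) * a n := by simpa using hsum 1
  have hsum0 : Summable a := by
    simpa using summable_mul_of_quadratic_bound ha (w := fun _ => 1) fun n => by
      rw [norm_one]
      exact one_le_pow₀ (by linarith [n.cast_nonneg (α := ℝ)])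
  have hmain : ∀ k, 2 ≤ k → ∑' n, (harmonic (n / k) : ℂ) * a n =
      ∑' n, (harmonic n : ℂ) * a n - Real.log k * ∑' n, a n := by
    intro k hk
    have h1 := ((hsum1.hasSum.sub (hsum k).hasSum).sub (hsum0.hasSum.mul_left (Real.log k : ℂ)))
    have h2 := h k hk
    have h3 : (fun n => (hCoeff k n : ℂ) * a n) = fun n => (harmonic n : ℂ) * a n -
        (harmonic (n / k) : ℂ) * a n - (Real.log k : ℂ) * a n := by
      funext n
      rw [hCoeff]
      push_cast
      ring
    rw [h3, h1.tsum_eq] at h2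
    linear_combination -h2
  have hlim : Tendsto (fun k => ∑' n, (harmonic (n / k) : ℂ) * a n) atTop (𝓝 0) := by
    have h1 : Tendsto (fun k => ∑' n, (harmonic (n / k) : ℂ) * a n) atTop
        (𝓝 (∑' _ : ℕ, (0 : ℂ))) := by
      refine tendsto_tsum_of_dominated_convergence ha (fun n => ?_)
        (Eventually.of_forall fun k n => ?_)
      · refine tendsto_const_nhds.congr' ?_
        filter_upwards [eventually_gt_atTop n] with k hk
        simp [Nat.div_eq_of_lt hk]
      · rw [norm_mul, mul_comm]
        exact mul_le_mul_of_nonneg_left (hharm k n) (norm_nonneg _)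
    simpa using h1
  have hlogmul : Tendsto (fun k : ℕ => (Real.log k : ℂ) * ∑' n, a n) atTop
      (𝓝 (∑' n, (harmonic n : ℂ) * a n)) := by
    have h1 := (tendsto_const_nhds (x := ∑' n, (harmonic n : ℂ) * a n)).sub hlim
    rw [sub_zero] at h1
    refine h1.congr' ?_
    filter_upwards [eventually_ge_atTop 2] with k hk
    rw [hmain k hk]
    ring
  have hlog : Tendsto (fun k : ℕ => Real.log k) atTop atTop :=
    Real.tendsto_log_atTop.comp tendsto_natCast_atTop_atTop
  have h0 : ∑' n, a n = 0 := by
    by_contra hne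
    refine not_tendsto_nhds_of_tendsto_atTop (hlog.atTop_mul_const (norm_pos_iff.mpr hne)) _
      (hlogmul.norm.congr' ?_)
    filter_upwards [hlog.eventually_ge_atTop 0] with k hk
    rw [norm_mul, Complex.norm_real, Real.norm_of_nonneg hk]
  have hS : ∑' n, (harmonic n : ℂ) * a n = 0 := by
    simp only [h0, mul_zero] at hlogmul
    exact tendsto_nhds_unique hlogmul tendsto_const_nhds
  refine eq_zero_of_tsum_harmonic_div_eq_zero ha h0 (fun k hk => ?_) n
  rcases hk.eq_or_lt with rfl | hk
  · simpa using hS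
  · rw [hmain k hk, h0, hS, mul_zero, sub_zero]

theorem summable_mul_sq_of_le_exp_neg_sqrt {u : ℕ → ℝ} {C c : ℝ} (hc : 0 < c)
    (hu : ∀ n, 0 ≤ u n) (h : ∀ n : ℕ, u n ≤ C * Real.exp (-c * Real.sqrt n)) :
    Summable fun n : ℕ => u n * ((n : ℝ) + 1) ^ 2 := by
  have h1 : (fun n : ℕ => Real.exp (-c * Real.sqrt n)) =O[atTop]
      fun n : ℕ => (Real.sqrt n) ^ (-8 : ℝ) :=
    ((isLittleO_exp_neg_mul_rpow_atTop hc (-8)).comp_tendsto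
      (Real.tendsto_sqrt_atTop.comp tendsto_natCast_atTop_atTop)).isBigO
  have h2 : (fun n : ℕ => ((n : ℝ) + 1) ^ 2) =O[atTop] fun n : ℕ => (n : ℝ) ^ 2 := by
    refine Asymptotics.IsBigO.of_bound 4 ?_
    filter_upwards [eventually_ge_atTop 1] with n hn
    have hn' : (1 : ℝ) ≤ n := by exact_mod_cast hn
    rw [Real.norm_of_nonneg (by positivity), Real.norm_of_nonneg (by positivity)]
    nlinarith
  have h3 : u =O[atTop] fun n : ℕ => Real.exp (-c * Real.sqrt n) :=
    Asymptotics.IsBigO.of_bound C <| Eventually.of_forall fun n => by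
      rw [Real.norm_of_nonneg (hu n), Real.norm_of_nonneg (Real.exp_pos _).le]
      exact h n
  refine summable_of_isBigO_nat (Real.summable_one_div_nat_pow.mpr one_lt_two)
    (((h3.trans h1).mul h2).congr' EventuallyEq.rfl ?_)
  filter_upwards [eventually_ge_atTop 1] with n hn
  have hn' : (0 : ℝ) < n := by exact_mod_cast hn
  rw [Real.sqrt_eq_rpow, ← Real.rpow_mul hn'.le]
  rw [show (1 / 2 * -8 : ℝ) = -((4 : ℕ) : ℝ) by norm_num, Real.rpow_neg hn'.le,
    Real.rpow_natCast]
  field_simp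

theorem tendsto_sum_hCoeff_mul_pow {k : ℕ} (hk : 0 < k) {z : ℂ} (hz : ‖z‖ = 1) (hzk : z ^ k ≠ 1) :
    Tendsto (fun N => ∑ n ∈ range N, (hCoeff k n : ℂ) * z ^ n) atTop (𝓝 (hFun k z)) := by
  have hz1 : z ≠ 1 := fun h => hzk (by rw [h, one_pow])
  have hsub : (1 : ℂ) - z ≠ 0 := sub_ne_zero.mpr hz1.symm
  have h1 := (tendsto_sum_pow_div_nat_neg_log hz hz1).comp (tendsto_add_atTop_nat 1)
  have hzk' : ‖z ^ k‖ = 1 := by rw [norm_pow, hz, one_pow]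
  have h2 := (tendsto_sum_pow_div_nat_neg_log hzk' hzk).comp
    ((tendsto_add_atTop_nat 1).comp (Nat.tendsto_div_const_atTop hk.ne'))
  have h3 : Tendsto (fun N => (hCoeff k N : ℂ) * z ^ N) atTop (𝓝 0) := by
    rw [tendsto_zero_iff_norm_tendsto_zero]
    simpa [norm_pow, hz] using (tendsto_hCoeff hk).norm
  have h4 := ((((h1.sub h2).sub_const (Real.log k : ℂ)).sub h3).div_const (1 - z))
  have heq : (-log (1 - z) - -log (1 - z ^ k) - (Real.log k : ℂ) - 0) / (1 - z) = hFun k z := by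
    rw [hFun, gFun]
    ring
  rw [heq] at h4
  refine h4.congr fun N => ?_
  rw [div_eq_iff hsub, mul_comm _ (1 - z), one_sub_mul_sum_hCoeff hk z N]
  rfl

instance fact_two_pi_pos : Fact (0 < 2 * Real.pi) := ⟨Real.two_pi_pos⟩

open AddCircle

/-- The embedding of `ℝ / 2πℤ` onto the unit circle of `ℂ`. -/
noncomputable def circlePoint (x : AddCircle (2 * Real.pi)) : ℂ := (toCircle x : ℂ)

theorem measurableEmbedding_circlePoint : MeasurableEmbedding circlePoint :=
  (Continuous.isClosedEmbedding (continuous_induced_dom.comp continuous_toCircle)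
    (Subtype.val_injective.comp (injective_toCircle Real.two_pi_pos.ne'))).measurableEmbedding

theorem norm_circlePoint (x : AddCircle (2 * Real.pi)) : ‖circlePoint x‖ = 1 :=
  Circle.norm_coe _

theorem fourier_eq_circlePoint_zpow (n : ℤ) (x : AddCircle (2 * Real.pi)) :
    fourier n x = circlePoint x ^ n := by
  rw [fourier_apply, toCircle_zsmul, Circle.coe_zpow, circlePoint]

theorem map_circlePoint_haar : Measure.map circlePoint haarAddCircle = mCirc := by
  have hT : ENNReal.ofReal (2 * Real.pi) ≠ 0 := by
    simpa using Real.pi_pos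
  have h1 : (haarAddCircle : Measure (AddCircle (2 * Real.pi))) =
      (ENNReal.ofReal (2 * Real.pi))⁻¹ • volume := by
    rw [volume_eq_smul_haarAddCircle, smul_smul,
      ENNReal.inv_mul_cancel hT ENNReal.ofReal_ne_top, one_smul]
  have h2 := (AddCircle.measurePreserving_mk (2 * Real.pi) 0).map_eq
  rw [zero_add] at h2
  rw [h1, Measure.map_smul, ← h2,
    Measure.map_map measurableEmbedding_circlePoint.measurable AddCircle.measurable_mk', mCirc]
  congr 2
  funext θ
  simp [circlePoint, toCircle_apply_mk, Circle.coe_exp, Real.pi_ne_zero]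

theorem integral_mCirc (F : ℂ → ℂ) :
    ∫ ω, F ω ∂mCirc = ∫ x, F (circlePoint x) ∂haarAddCircle := by
  rw [← map_circlePoint_haar, measurableEmbedding_circlePoint.integral_map]

theorem haarAddCircle_singleton (x : AddCircle (2 * Real.pi)) :
    (haarAddCircle : Measure (AddCircle (2 * Real.pi))) {x} = 0 := by
  have h := AddCircle.volume_closedBall (2 * Real.pi) (x := x) 0
  rw [Metric.closedBall_zero, volume_eq_smul_haarAddCircle] at h
  simpa [Real.pi_pos.not_ge] using h

theorem ae_circlePoint_pow_ne_one {k : ℕ} (hk : 0 < k) :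
    ∀ᵐ x ∂(haarAddCircle : Measure (AddCircle (2 * Real.pi))), circlePoint x ^ k ≠ 1 := by
  have hfin : {x : AddCircle (2 * Real.pi) | circlePoint x ^ k = 1}.Finite := by
    have : {z : ℂ | z ^ k = 1}.Finite := by
      refine (Polynomial.nthRoots k (1 : ℂ)).toFinset.finite_toSet.subset fun z hz => ?_
      simpa [Polynomial.mem_nthRoots hk] using hz
    exact this.preimage measurableEmbedding_circlePoint.injective.injOn
  have : NullSingletonClass (haarAddCircle : Measure (AddCircle (2 * Real.pi))) :=
    ⟨haarAddCircle_singleton⟩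
  rw [ae_iff]
  simpa using hfin.measure_zero _

theorem integral_hFun_mul_conj {k : ℕ} (hk : 0 < k)
    (F : Lp ℂ 2 (haarAddCircle : Measure (AddCircle (2 * Real.pi)))) :
    ∫ x, hFun k (circlePoint x) * (starRingEnd ℂ) (F x) ∂haarAddCircle =
      ∑' n : ℕ, (hCoeff k n : ℂ) * (starRingEnd ℂ) (fourierCoeff F n) := by
  have hv : Orthonormal ℂ fun n : ℕ => fourierLp (T := 2 * Real.pi) 2 (n : ℤ) :=
    orthonormal_fourier.comp _ Nat.cast_injective
  have hsummable : Summable fun n : ℕ =>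
      (hCoeff k n : ℂ) • fourierLp (T := 2 * Real.pi) 2 (n : ℤ) := by
    have h := (hv.orthogonalFamily.summable_iff_norm_sq_summable
      fun n => (hCoeff k n : ℂ)).mpr (by simpa using summable_hCoeff_sq hk)
    simpa using h
  obtain ⟨G, hG⟩ := hsummable
  have hGlim := hG.tendsto_sum_nat
  have hinner : inner ℂ F G =
      ∑' n : ℕ, (hCoeff k n : ℂ) * (starRingEnd ℂ) (fourierCoeff F n) := by
    have h1 := hG.mapL (innerSL ℂ F)
    refine h1.tsum_eq.symm.trans (tsum_congr fun n => ?_)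
    rw [innerSL_apply_apply, inner_smul_right, ← inner_conj_symm, ← fourierBasis_repr,
      HilbertBasis.repr_apply_apply, coe_fourierBasis]
  have hGae : G =ᵐ[haarAddCircle] fun x => hFun k (circlePoint x) := by
    obtain ⟨ns, hns, hae⟩ := (tendstoInMeasure_of_tendsto_Lp hGlim).exists_seq_tendsto_ae
    have hpart : ∀ N : ℕ, ∀ᵐ x ∂haarAddCircle,
        (∑ n ∈ range N, (hCoeff k n : ℂ) • fourierLp (T := 2 * Real.pi) 2 (n : ℤ) :
          Lp ℂ 2 haarAddCircle) x = ∑ n ∈ range N, (hCoeff k n : ℂ) * circlePoint x ^ n := by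
      intro N
      induction N with
      | zero =>
        simp
      | succ N ih =>
        rw [Finset.sum_range_succ]
        filter_upwards [ih, Lp.coeFn_add
            (∑ n ∈ range N, (hCoeff k n : ℂ) • fourierLp (T := 2 * Real.pi) 2 (n : ℤ))
            ((hCoeff k N : ℂ) • fourierLp (T := 2 * Real.pi) 2 (N : ℤ)),
          Lp.coeFn_smul (hCoeff k N : ℂ) (fourierLp (T := 2 * Real.pi) 2 (N : ℤ)),
          coeFn_fourierLp (T := 2 * Real.pi) 2 (N : ℤ)] with x h1 h2 h3 h4
        rw [h2, Pi.add_apply, h1, h3, Pi.smul_apply, h4, Finset.sum_range_succ,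
          fourier_eq_circlePoint_zpow, zpow_natCast, smul_eq_mul]
    filter_upwards [hae, ae_all_iff.mpr hpart, ae_circlePoint_pow_ne_one hk] with x h1 h2 h3
    simp only [h2] at h1
    exact tendsto_nhds_unique h1
      ((tendsto_sum_hCoeff_mul_pow hk (norm_circlePoint x) h3).comp hns.tendsto_atTop)
  rw [← hinner, L2.inner_def]
  refine integral_congr_ae ?_
  filter_upwards [hGae] with x hx
  rw [RCLike.inner_apply, hx]

/-- `𝒩^⊥` contains no nontrivial `f ∈ H²` whose Taylor (Fourier)
coefficients satisfy `f̂(n) = O(e^{-c√n})` for some `c > 0`. -/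
theorem orth_no_subexponential_coeffs
    (f : Lp ℂ 2 mCirc) (hf : f ∈ H2)
    (hdecay : ∃ C > (0 : ℝ), ∃ c > (0 : ℝ), ∀ n : ℕ,
      ‖∫ ω : ℂ, f ω * ω ^ (-(n : ℤ)) ∂mCirc‖ ≤ C * Real.exp (-c * Real.sqrt n))
    (horth : ∀ k, 2 ≤ k → (∫ ω : ℂ, hFun k ω * (starRingEnd ℂ) (f ω) ∂mCirc) = 0) :
    f = 0 := by
  have hmp : MeasurePreserving circlePoint haarAddCircle mCirc :=
    ⟨measurableEmbedding_circlePoint.measurable, map_circlePoint_haar⟩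
  have hmem : MemLp (fun x => f (circlePoint x)) 2 haarAddCircle :=
    (Lp.memLp f).comp_measurePreserving hmp
  set F := hmem.toLp
  have hF : F =ᵐ[haarAddCircle] fun x => f (circlePoint x) := hmem.coeFn_toLp
  have hcoeff : ∀ n : ℤ, fourierCoeff F n = ∫ ω : ℂ, f ω * ω ^ (-n) ∂mCirc := by
    intro n
    rw [integral_mCirc, fourierCoeff]
    refine integral_congr_ae ?_
    filter_upwards [hF] with x hx
    rw [hx, fourier_eq_circlePoint_zpow, smul_eq_mul, mul_comm]
  obtain ⟨C, -, c, hc, hdecay⟩ := hdecay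
  have ha : Summable fun n : ℕ =>
      ‖(starRingEnd ℂ) (fourierCoeff F n)‖ * ((n : ℝ) + 1) ^ 2 := by
    refine summable_mul_sq_of_le_exp_neg_sqrt (C := C) hc (fun n => norm_nonneg _) fun n => ?_
    rw [RCLike.norm_conj, hcoeff]
    exact hdecay n
  have hnat : ∀ n : ℕ, fourierCoeff F n = 0 := by
    intro n
    refine (map_eq_zero (starRingEnd ℂ)).mp
      (eq_zero_of_tsum_hCoeff_eq_zero ha (fun k hk => ?_) n)
    have hk0 : 0 < k := by lia
    have h1 := horth k hk
    rw [integral_mCirc] at h1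
    rw [← integral_hFun_mul_conj hk0 F, ← h1]
    refine integral_congr_ae ?_
    filter_upwards [hF] with x hx
    rw [hx]
  have hall : ∀ n : ℤ, fourierCoeff F n = 0 := by
    intro n
    rcases lt_or_ge n 0 with hn | hn
    · rw [hcoeff]
      exact hf n hn
    · lift n to ℕ using hn
      exact hnat n
  have hF0 : F = 0 := by
    have h := hasSum_fourier_series_L2 F
    simp only [hall, zero_smul] at h
    exact h.unique hasSum_zero
  have hae : ∀ᵐ ω ∂Measure.map circlePoint haarAddCircle, f ω = 0 := by
    rw [measurableEmbedding_circlePoint.ae_map_iff]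
    filter_upwards [hF, (Lp.eq_zero_iff_ae_eq_zero).mp hF0] with x h1 h2
    rw [← h1, h2, Pi.zero_apply]
  rw [map_circlePoint_haar] at hae
  exact (Lp.eq_zero_iff_ae_eq_zero).mpr hae
end
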